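/- Let n > p ≥ 0 be integers and ξ_1 ≤ ξ_2 ≤ ⋯ ≤ ξ_{n+p+1} a (p+1)-open knot sequence on [a,b] (i.e., ξ_1 = ⋯ = ξ_{p+1} = a, ξ_{n+1} = ⋯ = ξ_{n+p+1} = b, a < b) satisfying ξ_i < ξ_{i+p+1} for every i = 1, …, n (no knot value occurs more than p+1 times). Then the degree-p Cox–de Boor B-splines B_{1,p}, …, B_{n,p} are linearly independent as functions on [a, b): if c_1, …, c_n ∈ ℝ satisfy Σ_{i=1}^{n} c_i B_{i,p}(x) = 0 for all x ∈ [a, b), then c_1 = ⋯ = c_n = 0. -/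

import Mathlib

/-- The Cox–de Boor B-splines B_{i,p} associated with a knot sequence ξ.
Note that in Lean, division by zero yields zero, which implements exactly the
convention that a fraction with zero denominator is taken to be zero. -/
noncomputable def coxDeBoor (ξ : ℕ → ℝ) : ℕ → ℕ → ℝ → ℝ
  | i, 0, x => if ξ i ≤ x ∧ x < ξ (i + 1) then 1 else 0
  | i, p + 1, x =>
      (x - ξ i) / (ξ (i + p + 1) - ξ i) * coxDeBoor ξ i p x
      + (ξ (i + p + 2) - x) / (ξ (i + p + 2) - ξ (i + 1)) * coxDeBoor ξ (i + 1) p x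

theorem coxDeBoor_eq_zero_of_lt {ξ : ℕ → ℝ} (hξ : Monotone ξ) {x : ℝ} (p : ℕ) :
    ∀ i, x < ξ i → coxDeBoor ξ i p x = 0 := by
  induction p with
  | zero =>
    intro i hx
    simp [coxDeBoor, hx.not_ge]
  | succ p ih =>
    intro i hx
    simp [coxDeBoor, ih i hx, ih (i + 1) (hx.trans_le (hξ i.le_succ))]

/-- To the right of a knot `ξ m`, a B-spline starting at that knot is
`(x - ξ m) ^ (i + p - m)` times a continuous function that is positive at the knot. -/
theorem coxDeBoor_eq_pow_mul {ξ : ℕ → ℝ} (hξ : Monotone ξ) {m : ℕ}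
    (hm : ξ m < ξ (m + 1)) (p : ℕ) :
    ∀ i, i ≤ m → m ≤ i + p → ξ i = ξ m →
      ∃ g : ℝ → ℝ, Continuous g ∧ 0 < g (ξ m) ∧
        ∀ x, ξ m ≤ x → x < ξ (m + 1) →
          coxDeBoor ξ i p x = (x - ξ m) ^ (i + p - m) * g x := by
  induction p with
  | zero =>
    intro i him hmi _
    obtain rfl : i = m := by omega
    refine ⟨fun _ => 1, continuous_const, one_pos, fun x h₁ h₂ => ?_⟩
    simp [coxDeBoor, h₁, h₂]
  | succ p ih =>
    intro i him hmi hi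
    have hlast : ξ m < ξ (i + p + 2) := hm.trans_le (hξ (by omega))
    have hfirst : m ≤ i + p → ξ m < ξ (i + p + 1) := fun h => hm.trans_le (hξ (by omega))
    have hnext : i < m → ξ (i + 1) = ξ m := fun h =>
      le_antisymm (hξ h) (hi ▸ hξ i.le_succ)
    rcases Nat.lt_or_ge (i + p) m with hmp | hmp
    · obtain ⟨g, hg, hpos, hB⟩ := ih (i + 1) (by omega) (by omega) (hnext (by omega))
      refine ⟨fun x => (ξ (i + p + 2) - x) / (ξ (i + p + 2) - ξ m) * g x,
        by fun_prop, ?_, fun x h₁ h₂ => ?_⟩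
      · have := sub_pos.2 hlast
        positivity
      · have hz : ξ (i + p + 1) - ξ i = 0 := by
          rw [show i + p + 1 = m by omega, hi, sub_self]
        rw [coxDeBoor, hz, hB x h₁ h₂, hnext (by omega),
          show i + 1 + p - m = i + (p + 1) - m by omega]
        ring
    · obtain ⟨g, hg, hpos, hB⟩ := ih i him hmp hi
      have hd := sub_pos.2 (hfirst hmp)
      have hexp : i + (p + 1) - m = (i + p - m) + 1 := by omega
      rcases him.eq_or_lt with rfl | him
      · refine ⟨fun x => g x / (ξ (i + p + 1) - ξ i), by fun_prop, by positivity,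
          fun x h₁ h₂ => ?_⟩
        rw [coxDeBoor, hB x h₁ h₂, coxDeBoor_eq_zero_of_lt hξ p (i + 1) h₂, hexp]
        ring
      · obtain ⟨g', hg', hpos', hB'⟩ := ih (i + 1) him (by omega) (hnext him)
        refine ⟨fun x => g x / (ξ (i + p + 1) - ξ m) +
          (ξ (i + p + 2) - x) / (ξ (i + p + 2) - ξ m) * g' x, by fun_prop, ?_,
          fun x h₁ h₂ => ?_⟩
        · have := sub_pos.2 hlast
          positivity
        · rw [coxDeBoor, hB x h₁ h₂, hB' x h₁ h₂, hnext him, hi,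
            show i + 1 + p - m = i + p - m + 1 by omega, hexp]
          ring

/-- The last index carrying the same knot value as `i`, when that value is left within
`p + 1` steps. -/
theorem exists_last_eq_knot {ξ : ℕ → ℝ} (hξ : Monotone ξ) {i p : ℕ}
    (h : ξ i < ξ (i + p + 1)) :
    ∃ m, i ≤ m ∧ m ≤ i + p ∧ ξ i = ξ m ∧ ξ m < ξ (m + 1) := by
  induction p with
  | zero => exact ⟨i, le_rfl, le_rfl, rfl, h⟩
  | succ p ih =>
    rcases (hξ (show i ≤ i + p + 1 by omega)).eq_or_lt with heq | hlt
    · exact ⟨i + p + 1, by omega, by omega, heq, heq ▸ h⟩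
    · obtain ⟨m, h₁, h₂, h₃⟩ := ih hlt
      exact ⟨m, h₁, by omega, h₃⟩

open Filter Topology in
theorem tendsto_coxDeBoor_div_pow {ξ : ℕ → ℝ} (hξ : Monotone ξ) {i m p : ℕ}
    (him : i ≤ m) (hmp : m ≤ i + p) (hi : ξ i = ξ m) (hm : ξ m < ξ (m + 1)) :
    (∃ L > 0, Tendsto (fun x => coxDeBoor ξ i p x / (x - ξ m) ^ (i + p - m))
        (𝓝[>] ξ m) (𝓝 L)) ∧
      ∀ k, i < k → Tendsto (fun x => coxDeBoor ξ k p x / (x - ξ m) ^ (i + p - m))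
        (𝓝[>] ξ m) (𝓝 0) := by
  have hev : ∀ᶠ x in 𝓝[>] ξ m, ξ m < x ∧ x < ξ (m + 1) := Ioo_mem_nhdsGT hm
  constructor
  · obtain ⟨g, hg, hpos, hB⟩ := coxDeBoor_eq_pow_mul hξ hm p i him hmp hi
    refine ⟨g (ξ m), hpos, ((hg.tendsto _).mono_left nhdsWithin_le_nhds).congr' ?_⟩
    filter_upwards [hev] with x hx
    have := (sub_pos.2 hx.1).ne'
    rw [hB x hx.1.le hx.2]
    field_simp
  · intro k hk
    rcases Nat.lt_or_ge m k with hmk | hkm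
    · refine tendsto_const_nhds.congr' ?_
      filter_upwards [hev] with x hx
      rw [coxDeBoor_eq_zero_of_lt hξ p k (hx.2.trans_le (hξ hmk)), zero_div]
    · obtain ⟨g, hg, -, hB⟩ := coxDeBoor_eq_pow_mul hξ hm p k hkm (by omega)
        (le_antisymm (hξ hkm) (hi ▸ hξ hk.le))
      have hlim : Tendsto (fun x => (x - ξ m) ^ (k - i) * g x) (𝓝[>] ξ m) (𝓝 0) := by
        have hcont : Continuous fun x => (x - ξ m) ^ (k - i) * g x := by fun_prop
        have h := (hcont.tendsto (ξ m)).mono_left (nhdsWithin_le_nhds (s := Set.Ioi (ξ m)))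
        simpa [zero_pow (Nat.sub_ne_zero_of_lt hk)] using h
      refine hlim.congr' ?_
      filter_upwards [hev] with x hx
      have := (sub_pos.2 hx.1).ne'
      rw [hB x hx.1.le hx.2, show k + p - m = (i + p - m) + (k - i) by omega, pow_add]
      field_simp

open Filter Topology in
/-- for a (p+1)-open knot sequence on [a,b] in which no knot value is
repeated more than p+1 times, the degree-p B-splines B_{0,p}, …, B_{n-1,p}
(0-based indexing) are linearly independent as functions on [a,b). -/
theorem stmt17 (n p : ℕ) (hp : p < n) (a b : ℝ) (hab : a < b)
    (ξ : ℕ → ℝ) (hξ : Monotone ξ)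
    (hopen_left : ∀ i ≤ p, ξ i = a)
    (hopen_right : ∀ i, n ≤ i → i ≤ n + p → ξ i = b)
    (hsimple : ∀ i < n, ξ i < ξ (i + p + 1))
    (c : ℕ → ℝ)
    (hc : ∀ x : ℝ, a ≤ x → x < b → ∑ i ∈ Finset.range n, c i * coxDeBoor ξ i p x = 0) :
    ∀ i < n, c i = 0 := by
  intro i
  induction i using Nat.strong_induction_on with
  | _ i ih =>
    intro hin
    obtain ⟨m, him, hmp, hi, hm⟩ := exists_last_eq_knot hξ (hsimple i hin)
    obtain ⟨⟨L, hL, hlim⟩, hlim'⟩ := tendsto_coxDeBoor_div_pow hξ him hmp hi hm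
    have hsum : Tendsto (fun x => ∑ k ∈ Finset.range n,
        c k * (coxDeBoor ξ k p x / (x - ξ m) ^ (i + p - m))) (𝓝[>] ξ m)
        (𝓝 (∑ k ∈ Finset.range n, if k = i then c i * L else 0)) := by
      refine tendsto_finsetSum _ fun k hk => ?_
      rcases lt_trichotomy k i with h | rfl | h
      · simp [ih k h (h.trans hin), h.ne]
      · simpa using hlim.const_mul (c k)
      · simpa [h.ne'] using (hlim' k h).const_mul (c k)
    have hzero : Tendsto (fun x => ∑ k ∈ Finset.range n,
        c k * (coxDeBoor ξ k p x / (x - ξ m) ^ (i + p - m))) (𝓝[>] ξ m) (𝓝 0) := by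
      refine tendsto_const_nhds.congr' ?_
      filter_upwards [Ioo_mem_nhdsGT hm] with x hx
      have hax : a ≤ x := (hopen_left 0 p.zero_le ▸ hξ m.zero_le).trans hx.1.le
      have hxb : x < b := hx.2.trans_le
        (hopen_right (n + p) (by omega) le_rfl ▸ hξ (by omega))
      simp only [← mul_div_assoc]
      rw [← Finset.sum_div, hc x hax hxb, zero_div]
    have h := tendsto_nhds_unique hsum hzero
    simpa [hin, hL.ne'] using h
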